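/- Let i, j be integers with i ≥ 1 and 0 ≤ j ≤ i, let G be a graph in the family F_{i,j}, and set ε = (5−i)/7 if i ≤ 5 and ε = 0 if i ≥ 5. Then for every vertex v of G, φ(G − v) ≤ (2|E(G)| − |V(G)| + 2)/7 + ε − 1; in particular, for every vertex v of G there exists a feedback vertex set S of G with v ∈ S and |S| ≤ (2|E(G)| − |V(G)| + 2)/7 + ε. -/

import Mathlib

open SimpleGraph

/-- The minimum size of a feedback vertex set of `G`. -/
noncomputable def phi {V : Type} (G : SimpleGraph V) : ℕ :=
  sInf {n : ℕ | ∃ S : Finset V, S.card = n ∧ (G.induce ((S : Set V)ᶜ)).IsAcyclic}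

/-- The graph obtained from `H` by subdividing the edge `uv` once: delete the edge `uv`
and add a new vertex (`none`) adjacent exactly to `u` and `v`. -/
def subdivideEdge {V : Type} (H : SimpleGraph V) (u v : V) : SimpleGraph (Option V) :=
  SimpleGraph.fromRel (fun x y =>
    (∃ p q : V, x = some p ∧ y = some q ∧ H.Adj p q ∧ s(p, q) ≠ s(u, v)) ∨
    (x = none ∧ (y = some u ∨ y = some v)))

/-- `a` has degree exactly two in `H`. -/
def HasDegreeTwo {V : Type} (H : SimpleGraph V) (a : V) : Prop :=
  ∃ x y : V, x ≠ y ∧ H.Adj a x ∧ H.Adj a y ∧ ∀ z : V, H.Adj a z → z = x ∨ z = y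

/-- The operation `∘` applied with two distinct edges `u₁v₁`, `u₂v₂` and a degree-two vertex `a`:
subdivide both edges (new vertices `inr 0`, `inr 1`), then add a new vertex `inr 2` adjacent to
`a` and the two subdivision vertices. -/
def circOpTwo {V : Type} (H : SimpleGraph V) (u₁ v₁ u₂ v₂ a : V) : SimpleGraph (V ⊕ Fin 3) :=
  SimpleGraph.fromRel (fun x y =>
    (∃ p q : V, x = Sum.inl p ∧ y = Sum.inl q ∧ H.Adj p q ∧
      s(p, q) ≠ s(u₁, v₁) ∧ s(p, q) ≠ s(u₂, v₂)) ∨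
    (x = Sum.inr 0 ∧ (y = Sum.inl u₁ ∨ y = Sum.inl v₁)) ∨
    (x = Sum.inr 1 ∧ (y = Sum.inl u₂ ∨ y = Sum.inl v₂)) ∨
    (x = Sum.inr 2 ∧ (y = Sum.inl a ∨ y = Sum.inr 0 ∨ y = Sum.inr 1)))

/-- The operation `∘` applied with `e₁ = e₂ = uv` and a degree-two vertex `a`: subdivide the
edge `uv` twice (replacing it by the path `u, inr 0, inr 1, v`), then add a new vertex `inr 2`
adjacent to `a` and the two subdivision vertices. -/
def circOpOne {V : Type} (H : SimpleGraph V) (u v a : V) : SimpleGraph (V ⊕ Fin 3) :=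
  SimpleGraph.fromRel (fun x y =>
    (∃ p q : V, x = Sum.inl p ∧ y = Sum.inl q ∧ H.Adj p q ∧ s(p, q) ≠ s(u, v)) ∨
    (x = Sum.inr 0 ∧ (y = Sum.inl u ∨ y = Sum.inr 1)) ∨
    (x = Sum.inr 1 ∧ y = Sum.inl v) ∨
    (x = Sum.inr 2 ∧ (y = Sum.inl a ∨ y = Sum.inr 0 ∨ y = Sum.inr 1)))

/-- `G` is obtained from `H` by one application of the operation `∘` at the degree-two
vertex `a`, using two (not necessarily distinct) edges of `H`. -/
def IsCircOp {V : Type} (H : SimpleGraph V) (a : V) (G : SimpleGraph (V ⊕ Fin 3)) : Prop :=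
  (∃ u₁ v₁ u₂ v₂ : V, H.Adj u₁ v₁ ∧ H.Adj u₂ v₂ ∧ s(u₁, v₁) ≠ s(u₂, v₂) ∧
      G = circOpTwo H u₁ v₁ u₂ v₂ a) ∨
  (∃ u v : V, H.Adj u v ∧ G = circOpOne H u v a)

/-- Membership (up to isomorphism) in the family `F_{i,j}`. -/
inductive IsInF : ∀ (i j : ℕ) {V : Type}, SimpleGraph V → Prop
  | cycle (i : ℕ) (hi : 3 ≤ i) : IsInF i 0 (SimpleGraph.cycleGraph i)
  | k4 : IsInF 1 1 (⊤ : SimpleGraph (Fin 4))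
  | subdiv {i j : ℕ} {V : Type} {H : SimpleGraph V} {u v : V}
      (huv : H.Adj u v) (hH : IsInF i j H) : IsInF (i + 1) j (subdivideEdge H u v)
  | op {i j : ℕ} {V : Type} {H : SimpleGraph V} {a : V} {G : SimpleGraph (V ⊕ Fin 3)}
      (ha : HasDegreeTwo H a) (hG : IsCircOp H a G) (hH : IsInF i j H) : IsInF i (j + 1) G
  | iso {i j : ℕ} {V W : Type} {H : SimpleGraph V} {G : SimpleGraph W}
      (e : Nonempty (G ≃g H)) (hH : IsInF i j H) : IsInF i j G

/-- `G` is a graph obtained from `H` by repeatedly (possibly zero times) subdividing edges. -/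
inductive IsSubdivisionOf : ∀ {V : Type}, SimpleGraph V → ∀ {W : Type}, SimpleGraph W → Prop
  | refl {V : Type} (G : SimpleGraph V) : IsSubdivisionOf G G
  | step {V W : Type} {H : SimpleGraph V} {G : SimpleGraph W} {u v : W}
      (huv : G.Adj u v) (h : IsSubdivisionOf H G) : IsSubdivisionOf H (subdivideEdge G u v)

/-- `G` contains an induced subdivision of `H`: some induced subgraph of `G` is isomorphic
to a graph obtained from `H` by repeatedly subdividing edges. -/
def ContainsInducedSubdivision {V W : Type} (G : SimpleGraph V) (H : SimpleGraph W) : Prop :=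
  ∃ (s : Set V) (U : Type) (K : SimpleGraph U),
    IsSubdivisionOf H K ∧ Nonempty (G.induce s ≃g K)

/-- The family `𝓕`: members of `F_{4,2} ∪ F_{4,3}` of girth at least five, together with
members `H` of `F_{3,2} ∪ F_{3,3}` having an edge `e` such that `H − e` has girth at least
five. -/
def InFamilyF {W : Type} (H : SimpleGraph W) : Prop :=
  ((IsInF 4 2 H ∨ IsInF 4 3 H) ∧ 5 ≤ H.girth) ∨
  ((IsInF 3 2 H ∨ IsInF 3 3 H) ∧ ∃ e ∈ H.edgeSet, 5 ≤ (H.deleteEdges {e}).girth)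

/-- `G` contains two vertex-disjoint cycles, each of length less than five. -/
def HasTwoDisjointShortCycles {V : Type} (G : SimpleGraph V) : Prop :=
  ∃ (u v : V) (c₁ : G.Walk u u) (c₂ : G.Walk v v), c₁.IsCycle ∧ c₂.IsCycle ∧
    c₁.length < 5 ∧ c₂.length < 5 ∧ ∀ x : V, x ∈ c₁.support → x ∉ c₂.support

/-- No nonempty vertex set avoiding `S` in which every vertex has two `r`-neighbours. -/
def CoreFree {V : Type} (r : V → V → Prop) (S : Finset V) : Prop :=
  ∀ T : Set V, (∀ t ∈ T, t ∉ S) →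
    (∀ t ∈ T, ∃ x ∈ T, ∃ y ∈ T, x ≠ y ∧ r t x ∧ r t y) → ∀ t, t ∉ T

lemma coreFree_acyclic {V : Type} (G : SimpleGraph V) (S : Finset V)
    (h : CoreFree G.Adj S) : (G.induce ((S : Set V)ᶜ)).IsAcyclic := by
  classical
  intro v c hc
  refine h (Subtype.val '' {x | x ∈ c.support}) ?_ ?_ v.1 ⟨v, c.start_mem_support, rfl⟩
  · rintro t ⟨x, -, rfl⟩
    exact fun hx => x.2 hx
  · rintro t ⟨x, hx, rfl⟩
    have hr := hc.rotate hx
    refine ⟨_, ⟨(c.rotate x hx).snd, ?_, rfl⟩, _, ⟨(c.rotate x hx).penultimate, ?_, rfl⟩, ?_, ?_, ?_⟩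
    · exact (c.mem_support_rotate_iff x hx).1 ((c.rotate x hx).getVert_mem_support 1)
    · exact (c.mem_support_rotate_iff x hx).1 ((c.rotate x hx).getVert_mem_support _)
    · intro he
      exact hr.snd_ne_penultimate (Subtype.ext he)
    · exact (c.rotate x hx).adj_snd hr.not_nil
    · exact ((c.rotate x hx).adj_penultimate hr.not_nil).symm

lemma coreFree_transfer {V W : Type} {r : W → W → Prop} {r' : V → V → Prop} {S : Finset V}
    (h : CoreFree r' S) (T : Set W) (f : V → W) (c : V → V → W)
    (hT : ∀ t ∈ T, ∃ x ∈ T, ∃ y ∈ T, x ≠ y ∧ r t x ∧ r t y)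
    (hS : ∀ p ∈ S, f p ∉ T)
    (hc : ∀ p x, f p ∈ T → x ∈ T → r (f p) x → ∃ q, f q ∈ T ∧ r' p q ∧ x = c p q) :
    ∀ p, f p ∉ T := by
  refine h {p | f p ∈ T} (fun p hp hpS => hS p hpS hp) ?_
  intro p hp
  obtain ⟨x, hx, y, hy, hxy, h1, h2⟩ := hT _ hp
  obtain ⟨q, hq, hr, rfl⟩ := hc p x hp hx h1
  obtain ⟨q', hq', hr', rfl⟩ := hc p y hp hy h2
  exact ⟨q, hq, q', hq', fun e => hxy (by rw [e]), hr, hr'⟩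

/-- The strengthened inductive invariant. -/
structure FInv (i j : ℕ) {V : Type} (G : SimpleGraph V) : Prop where
  fin : Finite V
  cardV : Nat.card V = i + 3 * j
  cardE : i + 5 * j ≤ G.edgeSet.ncard
  vert : ∀ v, ∃ S : Finset V, v ∈ S ∧ S.card ≤ j + 1 ∧ CoreFree G.Adj S
  edge : ∀ u v, G.Adj u v → ∃ S : Finset V, S.card ≤ j ∧
    CoreFree (fun p q => G.Adj p q ∧ s(p, q) ≠ s(u, v)) S

lemma inv_k4 : FInv 1 1 (⊤ : SimpleGraph (Fin 4)) where
  fin := inferInstance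
  cardV := by simp
  cardE := by
    rw [Set.ncard_eq_toFinset_card']
    decide
  vert v := by
    refine ⟨{v, v + 1}, by simp, Finset.card_le_two, ?_⟩
    intro T h1 h2
    have : ∀ t, t ∈ T → t = v + 2 ∨ t = v + 3 := by
      intro t ht
      have := h1 t ht
      revert this
      clear * -
      revert t v; decide
    intro t ht
    obtain ⟨x, hx, y, hy, hxy, ha, hb⟩ := h2 t ht
    rw [top_adj] at ha hb
    grind
  edge u v huv := by
    have : ∃ w z : Fin 4, ∀ t, t = z ∨ t = u ∨ t = v ∨ t = w := by
      revert u v; decide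
    obtain ⟨w, z, hwz⟩ := this
    refine ⟨{z}, by simp, ?_⟩
    intro T h1 h2
    have hw : ∀ t, t ∈ T → t = u ∨ t = v ∨ t = w := by
      intro t ht
      have h3 := h1 t ht
      rw [Finset.mem_singleton] at h3
      exact (hwz t).resolve_left h3
    have key : ∀ t ∈ T, t = w := by
      intro t ht
      obtain ⟨x, hx, y, hy, hxy, ha, hb⟩ := h2 t ht
      rw [top_adj] at ha hb
      have := hw t ht
      have := hw x hx
      have := hw y hy
      have e := @Sym2.eq_swap _ u v
      grind
    intro t ht
    obtain ⟨x, hx, y, hy, hxy, ha, hb⟩ := h2 t ht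
    exact hxy ((key x hx).trans (key y hy).symm)

lemma cycle_core {n : ℕ} (T : Set (Fin (n + 3))) (r : Fin (n+3) → Fin (n+3) → Prop)
    (hr : ∀ x y, r x y → (cycleGraph (n + 3)).Adj x y)
    (h2 : ∀ t ∈ T, ∃ x ∈ T, ∃ y ∈ T, x ≠ y ∧ r t x ∧ r t y) (t) (ht : t ∈ T) :
    ∀ s, s ∈ T ∧ r s (s + 1) ∧ r s (s - 1) := by
  have step : ∀ s ∈ T, s + 1 ∈ T ∧ r s (s + 1) ∧ r s (s - 1) := by
    intro s hs
    obtain ⟨x, hx, y, hy, hxy, ha, hb⟩ := h2 s hs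
    have ha' := hr _ _ ha
    have hb' := hr _ _ hb
    rw [cycleGraph_adj] at ha' hb'
    have e : ∀ z, s - z = 1 ∨ z - s = 1 → z = s - 1 ∨ z = s + 1 := by
      intro z hz
      rcases hz with h | h
      · left; rw [← h]; abel
      · right; rw [← h]; abel
    rcases e x ha' with rfl | rfl <;> rcases e y hb' with rfl | rfl
    · exact absurd rfl hxy
    · exact ⟨hy, hb, ha⟩
    · exact ⟨hx, ha, hb⟩
    · exact absurd rfl hxy
  have all : ∀ k : ℕ, t + (Fin.ofNat (n+3) k) ∈ T := by
    intro k
    induction k with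
    | zero => simpa using ht
    | succ k ih =>
      have := (step _ ih).1
      convert this using 1
      rw [add_assoc]; congr 1
      ext; simp [Fin.val_add]
  intro s
  have hs : s ∈ T := by
    have := all (s - t).val
    simpa using this
  exact ⟨hs, (step s hs).2⟩

lemma inv_cycle (i : ℕ) (hi : 3 ≤ i) : FInv i 0 (cycleGraph i) := by
  obtain ⟨n, rfl⟩ := Nat.exists_eq_add_of_le' hi
  refine ⟨inferInstance, by simp, ?_, ?_, ?_⟩
  · have := (cycleGraph (n+3)).sum_degrees_eq_twice_card_edges
    simp only [cycleGraph_degree_three_le] at this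
    rw [← coe_edgeFinset, Set.ncard_coe_finset]
    simp at this
    omega
  · intro v
    refine ⟨{v}, by simp, by simp, ?_⟩
    intro T h1 h2 t ht
    exact h1 v (cycle_core T _ (fun _ _ h => h) h2 t ht v).1 (by simp)
  · intro u v huv
    refine ⟨∅, by simp, ?_⟩
    intro T h1 h2 t ht
    have := cycle_core T _ (fun _ _ h => h.1) h2 t ht u
    rw [cycleGraph_adj] at huv
    rcases huv with h | h
    · apply this.2.2.2
      congr 2
      rw [← h]; abel
    · apply this.2.1.2
      congr 2
      rw [← h]; abel

lemma inv_iso {i j : ℕ} {V W : Type} {H : SimpleGraph V} {G : SimpleGraph W}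
    (e : G ≃g H) (h : FInv i j H) : FInv i j G := by
  classical
  have tr : ∀ (r : V → V → Prop) (r' : W → W → Prop) (S : Finset V),
      (∀ x y, r' x y → r (e x) (e y)) →
      CoreFree r S → CoreFree r' (S.map e.symm.toEquiv.toEmbedding) := by
    intro r r' S hr hS T h1 h2 t ht
    refine coreFree_transfer hS T e.symm (fun _ q => e.symm q) h2 ?_ ?_ (e t) (by simpa using ht)
    · intro p hp hpT
      exact h1 _ hpT (Finset.mem_map_of_mem _ hp)
    · intro p x hp hx hpx
      refine ⟨e x, by simpa using hx, by simpa using hr _ _ hpx, by simp⟩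
  refine ⟨?_, ?_, ?_, ?_, ?_⟩
  · have := h.fin
    exact Finite.of_equiv V e.symm.toEquiv
  · rw [← h.cardV]; exact Nat.card_congr e.toEquiv
  · have := h.cardE
    rwa [show G.edgeSet.ncard = H.edgeSet.ncard from Nat.card_congr e.mapEdgeSet]
  · intro v
    obtain ⟨S, hv, hc, hS⟩ := h.vert (e v)
    refine ⟨S.map e.symm.toEquiv.toEmbedding, ?_, by simpa using hc, tr _ _ S ?_ hS⟩
    · rw [Finset.mem_map]
      exact ⟨e v, hv, by simp⟩
    · intro x y hxy; exact e.map_adj_iff.2 hxy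
  · intro u v huv
    obtain ⟨S, hc, hS⟩ := h.edge (e u) (e v) (e.map_adj_iff.2 huv)
    refine ⟨S.map e.symm.toEquiv.toEmbedding, by simpa using hc, tr _ _ S ?_ hS⟩
    intro x y hxy
    refine ⟨e.map_adj_iff.2 hxy.1, ?_⟩
    have := hxy.2
    simpa [Sym2.eq_iff] using this

lemma subdiv_some {V : Type} (H : SimpleGraph V) (u v p q : V) :
    (subdivideEdge H u v).Adj (some p) (some q) ↔ H.Adj p q ∧ s(p, q) ≠ s(u, v) := by
  have := @Sym2.eq_swap _ p q
  simp only [subdivideEdge, fromRel_adj]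
  have := H.adj_comm p q
  have := H.ne_of_adj (a := p) (b := q)
  grind

lemma subdiv_none {V : Type} (H : SimpleGraph V) (u v p : V) :
    (subdivideEdge H u v).Adj none (some p) ↔ p = u ∨ p = v := by
  simp [subdivideEdge, fromRel_adj]

lemma subdiv_none' {V : Type} (H : SimpleGraph V) (u v p : V) :
    (subdivideEdge H u v).Adj (some p) none ↔ p = u ∨ p = v := by
  rw [adj_comm, subdiv_none]

lemma subdiv_core {V : Type} {H : SimpleGraph V} {u v : V} (huv : H.Adj u v)
    (D : Set (Sym2 V)) {S : Finset V}
    (hS : CoreFree (fun p q => H.Adj p q ∧ s(p, q) ∉ D) S)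
    (r : Option V → Option V → Prop) (hr : ∀ x y, r x y → (subdivideEdge H u v).Adj x y)
    (T : Set (Option V)) (hT : ∀ t ∈ T, ∃ x ∈ T, ∃ y ∈ T, x ≠ y ∧ r t x ∧ r t y)
    (hST : ∀ p ∈ S, some p ∉ T)
    (hD : ∀ p q, s(p, q) ∈ D → ¬ r (some p) (some q))
    (hD' : s(u, v) ∈ D → none ∉ T) : ∀ t, t ∉ T := by
  classical
  have hn : none ∈ T → some u ∈ T ∧ some v ∈ T := by
    intro h
    obtain ⟨x, hx, y, hy, hxy, ha, hb⟩ := hT _ h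
    have ha := hr _ _ ha
    have hb := hr _ _ hb
    rcases x with _ | x
    · exact absurd rfl ha.ne
    rcases y with _ | y
    · exact absurd rfl hb.ne
    rw [subdiv_none] at ha hb
    grind
  have key : ∀ p, some p ∉ T := by
    refine coreFree_transfer hS T some (fun p q => if s(p, q) = s(u, v) then none else some q)
      hT hST ?_
    intro p x hp hx hpx
    have ha := hr _ _ hpx
    rcases x with _ | x
    · rw [subdiv_none'] at ha
      rcases ha with rfl | rfl
      · exact ⟨v, (hn hx).2, ⟨huv, fun h => hD' h hx⟩, by simp⟩
      · refine ⟨u, (hn hx).1, ⟨huv.symm, fun h => hD' ?_ hx⟩, by simp⟩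
        rwa [Sym2.eq_swap]
    · rw [subdiv_some] at ha
      exact ⟨x, hx, ⟨ha.1, fun h => hD _ _ h hpx⟩, by simp [ha.2]⟩
  rintro (_ | t) ht
  · exact key u (hn ht).1
  · exact key t ht

lemma ncard_diff_ge {α : Type} (s t : Set α) [Finite α] (k : ℕ) (ht : t.ncard ≤ k) :
    s.ncard ≤ (s \ t).ncard + k := by
  have := Set.ncard_le_ncard_sdiff_add_ncard s t
  omega

lemma inv_subdiv {i j : ℕ} {V : Type} {H : SimpleGraph V} {u v : V}
    (huv : H.Adj u v) (h : FInv i j H) : FInv (i + 1) j (subdivideEdge H u v) := by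
  classical
  have hfin := h.fin
  have hfin' : Finite (Option V) := inferInstance
  refine ⟨hfin', ?_, ?_, ?_, ?_⟩
  · rw [Finite.card_option, h.cardV]; omega
  · have hsub : (Sym2.map some '' (H.edgeSet \ {s(u, v)})) ∪ {s(none, some u), s(none, some v)} ⊆
        (subdivideEdge H u v).edgeSet := by
      rintro e (⟨e, he, rfl⟩ | he)
      · induction e with | _ p q
        rw [Sym2.map_mk, mem_edgeSet]
        exact (subdiv_some H u v p q).2 he
      · rcases he with rfl | rfl
        · exact (subdiv_none H u v u).2 (Or.inl rfl)
        · exact (subdiv_none H u v v).2 (Or.inr rfl)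
    have h1 := Set.ncard_le_ncard hsub (Set.toFinite _)
    rw [Set.ncard_union_eq, Set.ncard_image_of_injective _ (Sym2.map.injective (Option.some_injective _)),
      Set.ncard_pair] at h1
    · have := ncard_diff_ge H.edgeSet {s(u, v)} 1 (by simp)
      have := h.cardE
      omega
    · have := huv.ne
      simp [this]
    · rw [Set.disjoint_left]
      rintro _ ⟨e, he, rfl⟩ h2
      induction e with | _ p q
      simp at h2
  · rintro (_ | w)
    · obtain ⟨S, hc, hS⟩ := h.edge u v huv
      refine ⟨insert none (S.map Function.Embedding.some), by simp, ?_, ?_⟩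
      · have := Finset.card_insert_le none (S.map Function.Embedding.some)
        simp only [Finset.card_map] at this
        omega
      · intro T h1 h2
        refine subdiv_core huv {s(u, v)} hS _ (fun _ _ h => h) T h2 ?_ ?_ ?_
        · intro p hp hT
          exact h1 _ hT (by simp [hp])
        · intro p q hpq hr
          rw [subdiv_some] at hr
          exact hr.2 hpq
        · intro _ hT
          exact h1 _ hT (by simp)
    · obtain ⟨S, hw, hc, hS⟩ := h.vert w
      refine ⟨S.map Function.Embedding.some, by simpa using hw, by simpa using hc, ?_⟩
      intro T h1 h2
      refine subdiv_core huv ∅ (by simpa using hS) _ (fun _ _ h => h) T h2 ?_ (by simp) (by simp)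
      intro p hp hT
      exact h1 _ hT (by simp [hp])
  · have halves : ∀ w, w = u ∨ w = v → ∃ S : Finset (Option V), S.card ≤ j ∧
        CoreFree (fun p q => (subdivideEdge H u v).Adj p q ∧ s(p, q) ≠ s(none, some w)) S := by
      intro w hw
      obtain ⟨S, hc, hS⟩ := h.edge u v huv
      refine ⟨S.map Function.Embedding.some, by simpa using hc, ?_⟩
      intro T h1 h2
      refine subdiv_core huv {s(u, v)} hS _ (fun _ _ h => h.1) T h2 ?_ ?_ ?_
      · intro p hp hT
        exact h1 _ hT (by simp [hp])
      · intro p q hpq hr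
        have := hr.1
        rw [subdiv_some] at this
        exact this.2 hpq
      · intro _ hT
        obtain ⟨x, hx, y, hy, hxy, ⟨ha, ha'⟩, ⟨hb, hb'⟩⟩ := h2 _ hT
        rcases x with _ | x
        · exact absurd rfl ha.ne
        rcases y with _ | y
        · exact absurd rfl hb.ne
        rw [subdiv_none] at ha hb
        grind
    rintro (_ | p) (_ | q) hpq
    · exact absurd rfl hpq.ne
    · exact halves q (by rwa [subdiv_none] at hpq)
    · rw [Sym2.eq_swap]
      exact halves p (by rwa [subdiv_none'] at hpq)
    · rw [subdiv_some] at hpq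
      obtain ⟨S, hc, hS⟩ := h.edge p q hpq.1
      refine ⟨S.map Function.Embedding.some, by simpa using hc, ?_⟩
      intro T h1 h2
      refine subdiv_core huv {s(p, q)} hS _ (fun _ _ h => h.1) T h2 ?_ ?_ ?_
      · intro p hp hT
        exact h1 _ hT (by simp [hp])
      · intro a b hab hr
        apply hr.2
        have := congrArg (Sym2.map some) (Set.mem_singleton_iff.1 hab)
        simpa using this
      · intro h3
        exact absurd (Set.mem_singleton_iff.1 h3).symm hpq.2

/-- Every vertex of `T` has two `r`-neighbours in `T`. -/
def IsCoreSet {V : Type} (r : V → V → Prop) (T : Set V) : Prop :=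
  ∀ t ∈ T, ∃ x ∈ T, ∃ y ∈ T, x ≠ y ∧ r t x ∧ r t y

/-- The features shared by the two forms of the operation. -/
structure CircAbs {V : Type} (H : SimpleGraph V) (G : SimpleGraph (V ⊕ Fin 3))
    (E : Fin 3 → Sym2 V) (a : V) : Prop where
  mem : ∀ m, m ≠ 2 → E m ∈ H.edgeSet
  inl_inl : ∀ p q, G.Adj (Sum.inl p) (Sum.inl q) → H.Adj p q ∧ ∀ m, m ≠ 2 → s(p, q) ≠ E m
  two : ∀ x, G.Adj (Sum.inr 2) x → x = Sum.inl a ∨ x = Sum.inr 0 ∨ x = Sum.inr 1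
  deg : ∀ m, m ≠ 2 → ∀ x, G.Adj (Sum.inr m) x → x ≠ Sum.inr 2 →
    ∀ r : V ⊕ Fin 3 → V ⊕ Fin 3 → Prop, (∀ x y, r x y → G.Adj x y) → ¬ r (Sum.inr m) x →
    ∀ T, IsCoreSet r T → Sum.inr 2 ∉ T → Sum.inr m ∉ T
  same : ∀ m m', m ≠ 2 → m' ≠ 2 → E m = E m' →
    ∀ r : V ⊕ Fin 3 → V ⊕ Fin 3 → Prop, (∀ x y, r x y → G.Adj x y) →
    ∀ T, IsCoreSet r T → Sum.inr 2 ∉ T → Sum.inr m ∉ T → Sum.inr m' ∉ T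
  core : ∀ (D : Set (Sym2 V)) (S : Finset V),
    CoreFree (fun p q => H.Adj p q ∧ s(p, q) ∉ D) S →
    ∀ r : V ⊕ Fin 3 → V ⊕ Fin 3 → Prop, (∀ x y, r x y → G.Adj x y) →
    ∀ T, IsCoreSet r T → Sum.inr 2 ∉ T →
    (∀ p ∈ S, Sum.inl p ∉ T) →
    (∀ p q, s(p, q) ∈ D → ¬ r (Sum.inl p) (Sum.inl q)) →
    (∀ m, m ≠ 2 → E m ∈ D → Sum.inr m ∉ T) → ∀ t, t ∉ T
  cardE : Finite V → H.edgeSet.ncard + 5 ≤ G.edgeSet.ncard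

lemma inv_circAbs {i j : ℕ} {V : Type} {H : SimpleGraph V} {G : SimpleGraph (V ⊕ Fin 3)}
    {E : Fin 3 → Sym2 V} {a : V} (C : CircAbs H G E a) (h : FInv i j H) : FInv i (j + 1) G := by
  classical
  have hfin := h.fin
  -- deleting the edge `E m` of `H`
  have hE : ∀ m, m ≠ 2 → ∃ S : Finset V, S.card ≤ j ∧
      CoreFree (fun p q => H.Adj p q ∧ s(p, q) ∉ ({E m} : Set (Sym2 V))) S := by
    intro m hm
    have := C.mem m hm
    induction hh : E m with | _ p q
    rw [hh] at this
    exact h.edge p q this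
  have fin1 : ∀ (m : Fin 3), m ≠ 2 → ∀ S : Finset V,
      CoreFree (fun p q => H.Adj p q ∧ s(p, q) ∉ ({E m} : Set (Sym2 V))) S →
      ∀ r : V ⊕ Fin 3 → V ⊕ Fin 3 → Prop, (∀ x y, r x y → G.Adj x y) →
      ∀ T, IsCoreSet r T → Sum.inr 2 ∉ T → (∀ p ∈ S, Sum.inl p ∉ T) → Sum.inr m ∉ T →
      ∀ t, t ∉ T := by
    intro m hm S hS r hr T hT h2 hST hmT
    refine C.core {E m} S hS r hr T hT h2 hST ?_ ?_
    · intro p q hpq hrpq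
      exact (C.inl_inl p q (hr _ _ hrpq)).2 m hm hpq
    · intro m' hm' he
      exact C.same m m' hm hm' (Set.mem_singleton_iff.1 he).symm r hr T hT h2 hmT
  refine ⟨inferInstance, ?_, ?_, ?_, ?_⟩
  · rw [Nat.card_sum, h.cardV]; simp; omega
  · have := C.cardE hfin
    have := h.cardE
    omega
  · have old : ∀ v, ∃ S : Finset (V ⊕ Fin 3), Sum.inl v ∈ S ∧ Sum.inr 2 ∈ S ∧
        S.card ≤ j + 1 + 1 ∧ CoreFree G.Adj S := by
      intro v
      obtain ⟨S, hv, hc, hS⟩ := h.vert v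
      refine ⟨insert (Sum.inr 2) (S.map Function.Embedding.inl), by simp [hv], by simp, ?_, ?_⟩
      · refine (Finset.card_insert_le _ _).trans ?_
        simpa using hc
      · intro T h1 h2
        refine C.core ∅ S (by simpa using hS) _ (fun _ _ h => h) T h2 ?_ ?_ (by simp) (by simp)
        · exact fun h3 => h1 _ h3 (by simp)
        · exact fun p hp h3 => h1 _ h3 (by simp [hp])
    rintro (v | m)
    · obtain ⟨S, h1, -, h2⟩ := old v
      exact ⟨S, h1, h2⟩
    · by_cases hm : m = 2
      · subst hm
        obtain ⟨S, -, h2⟩ := old a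
        exact ⟨S, h2⟩
      · obtain ⟨S, hc, hS⟩ := hE m hm
        refine ⟨insert (Sum.inr m) (insert (Sum.inr 2) (S.map Function.Embedding.inl)),
          by simp, ?_, ?_⟩
        · refine (Finset.card_insert_le _ _).trans ?_
          have := Finset.card_insert_le (Sum.inr 2) (S.map (Function.Embedding.inl (β := Fin 3)))
          simp only [Finset.card_map] at this
          omega
        · intro T h1 h2
          refine fin1 m hm S hS _ (fun _ _ h => h) T h2 ?_ ?_ ?_
          · exact fun h3 => h1 _ h3 (by simp)
          · exact fun p hp h3 => h1 _ h3 (by simp [hp])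
          · exact fun h3 => h1 _ h3 (by simp)
  · -- edges at the new vertex `inr 2`
    have e2 : ∀ x, G.Adj (Sum.inr 2) x → ∃ S : Finset (V ⊕ Fin 3), S.card ≤ j + 1 ∧
        CoreFree (fun p q => G.Adj p q ∧ s(p, q) ≠ s(Sum.inr 2, x)) S := by
      intro x hx
      by_cases hxa : x = Sum.inl a
      · subst hxa
        obtain ⟨S, hc, hS⟩ := hE 0 (by decide)
        refine ⟨insert (Sum.inr 0) (S.map Function.Embedding.inl), ?_, ?_⟩
        · refine (Finset.card_insert_le _ _).trans ?_
          simpa using hc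
        · intro T h1 h2
          have h0 : Sum.inr 0 ∉ T := fun h3 => h1 _ h3 (by simp)
          refine fin1 0 (by decide) S hS _ (fun _ _ h => h.1) T h2 ?_ ?_ h0
          · intro h3
            obtain ⟨x, hx, y, hy, hxy, ⟨ha, ha'⟩, ⟨hb, hb'⟩⟩ := h2 _ h3
            have := C.two x ha
            have := C.two y hb
            grind
          · exact fun p hp h3 => h1 _ h3 (by simp [hp])
      · obtain ⟨S, hv, hc, hS⟩ := h.vert a
        refine ⟨S.map Function.Embedding.inl, by simpa using hc, ?_⟩
        intro T h1 h2
        have h0 : Sum.inl a ∉ T := fun h3 => h1 _ h3 (by simp [hv])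
        refine C.core ∅ S (by simpa using hS) _ (fun _ _ h => h.1) T h2 ?_ ?_ (by simp) (by simp)
        · intro h3
          have := C.two x hx
          obtain ⟨x, hx, y, hy, hxy, ⟨ha, ha'⟩, ⟨hb, hb'⟩⟩ := h2 _ h3
          have := C.two x ha
          have := C.two y hb
          grind
        · exact fun p hp h3 => h1 _ h3 (by simp [hp])
    have e1 : ∀ m x, m ≠ 2 → x ≠ Sum.inr 2 → G.Adj (Sum.inr m) x →
        ∃ S : Finset (V ⊕ Fin 3), S.card ≤ j + 1 ∧
        CoreFree (fun p q => G.Adj p q ∧ s(p, q) ≠ s(Sum.inr m, x)) S := by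
      intro m x hm hx2 hx
      obtain ⟨S, hc, hS⟩ := hE m hm
      refine ⟨insert (Sum.inr 2) (S.map Function.Embedding.inl), ?_, ?_⟩
      · refine (Finset.card_insert_le _ _).trans ?_
        simpa using hc
      · intro T h1 h2
        have h0 : Sum.inr 2 ∉ T := fun h3 => h1 _ h3 (by simp)
        refine fin1 m hm S hS _ (fun _ _ h => h.1) T h2 h0 ?_ ?_
        · exact fun p hp h3 => h1 _ h3 (by simp [hp])
        · exact C.deg m hm x hx hx2 _ (fun _ _ h => h.1) (by simp) T h2 h0
    have e3 : ∀ m x, G.Adj (Sum.inr m) x → ∃ S : Finset (V ⊕ Fin 3), S.card ≤ j + 1 ∧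
        CoreFree (fun p q => G.Adj p q ∧ s(p, q) ≠ s(Sum.inr m, x)) S := by
      intro m x hx
      by_cases hm : m = 2
      · subst hm; exact e2 x hx
      · by_cases hx2 : x = Sum.inr 2
        · subst hx2
          rw [Sym2.eq_swap]
          exact e2 _ hx.symm
        · exact e1 m x hm hx2 hx
    rintro (p | m) x hx
    · rcases x with q | m
      · obtain ⟨hpq, hne⟩ := C.inl_inl p q hx
        obtain ⟨S, hc, hS⟩ := h.edge p q hpq
        refine ⟨insert (Sum.inr 2) (S.map Function.Embedding.inl), ?_, ?_⟩
        · refine (Finset.card_insert_le _ _).trans ?_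
          simpa using hc
        · intro T h1 h2
          refine C.core {s(p, q)} S hS _ (fun _ _ h => h.1) T h2 ?_ ?_ ?_ ?_
          · exact fun h3 => h1 _ h3 (by simp)
          · exact fun p hp h3 => h1 _ h3 (by simp [hp])
          · intro b c hbc hr
            apply hr.2
            have := congrArg (Sym2.map (Sum.inl (β := Fin 3))) (Set.mem_singleton_iff.1 hbc)
            simpa using this
          · intro m hm h3
            exact absurd (Set.mem_singleton_iff.1 h3).symm (hne m hm)
      · rw [Sym2.eq_swap]
        exact e3 m _ hx.symm
    · exact e3 m x hx

lemma circTwo_inl_inl {V : Type} (H : SimpleGraph V) (u₁ v₁ u₂ v₂ a p q : V) :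
    (circOpTwo H u₁ v₁ u₂ v₂ a).Adj (Sum.inl p) (Sum.inl q) ↔
      H.Adj p q ∧ s(p, q) ≠ s(u₁, v₁) ∧ s(p, q) ≠ s(u₂, v₂) := by
  have := @Sym2.eq_swap _ p q
  simp only [circOpTwo, fromRel_adj]
  have := H.adj_comm p q
  have := H.ne_of_adj (a := p) (b := q)
  grind

lemma circTwo_zero {V : Type} (H : SimpleGraph V) (u₁ v₁ u₂ v₂ a : V) (x : V ⊕ Fin 3) :
    (circOpTwo H u₁ v₁ u₂ v₂ a).Adj (Sum.inr 0) x ↔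
      x = Sum.inl u₁ ∨ x = Sum.inl v₁ ∨ x = Sum.inr 2 := by
  rcases x with x | x
  · simp [circOpTwo, fromRel_adj]
  · fin_cases x <;> simp [circOpTwo, fromRel_adj]

lemma circTwo_one {V : Type} (H : SimpleGraph V) (u₁ v₁ u₂ v₂ a : V) (x : V ⊕ Fin 3) :
    (circOpTwo H u₁ v₁ u₂ v₂ a).Adj (Sum.inr 1) x ↔
      x = Sum.inl u₂ ∨ x = Sum.inl v₂ ∨ x = Sum.inr 2 := by
  rcases x with x | x
  · simp [circOpTwo, fromRel_adj]
  · fin_cases x <;> simp [circOpTwo, fromRel_adj]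

lemma circTwo_two {V : Type} (H : SimpleGraph V) (u₁ v₁ u₂ v₂ a : V) (x : V ⊕ Fin 3) :
    (circOpTwo H u₁ v₁ u₂ v₂ a).Adj (Sum.inr 2) x ↔
      x = Sum.inl a ∨ x = Sum.inr 0 ∨ x = Sum.inr 1 := by
  rcases x with x | x
  · simp [circOpTwo, fromRel_adj]
  · fin_cases x <;> simp [circOpTwo, fromRel_adj]

lemma circOne_inl_inl {V : Type} (H : SimpleGraph V) (u v a p q : V) :
    (circOpOne H u v a).Adj (Sum.inl p) (Sum.inl q) ↔
      H.Adj p q ∧ s(p, q) ≠ s(u, v) := by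
  have := @Sym2.eq_swap _ p q
  simp only [circOpOne, fromRel_adj]
  have := H.adj_comm p q
  have := H.ne_of_adj (a := p) (b := q)
  grind

lemma circOne_zero {V : Type} (H : SimpleGraph V) (u v a : V) (x : V ⊕ Fin 3) :
    (circOpOne H u v a).Adj (Sum.inr 0) x ↔
      x = Sum.inl u ∨ x = Sum.inr 1 ∨ x = Sum.inr 2 := by
  rcases x with x | x
  · simp [circOpOne, fromRel_adj]
  · fin_cases x <;> simp [circOpOne, fromRel_adj]

lemma circOne_one {V : Type} (H : SimpleGraph V) (u v a : V) (x : V ⊕ Fin 3) :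
    (circOpOne H u v a).Adj (Sum.inr 1) x ↔
      x = Sum.inl v ∨ x = Sum.inr 0 ∨ x = Sum.inr 2 := by
  rcases x with x | x
  · simp [circOpOne, fromRel_adj]
  · fin_cases x <;> simp [circOpOne, fromRel_adj]

lemma circOne_two {V : Type} (H : SimpleGraph V) (u v a : V) (x : V ⊕ Fin 3) :
    (circOpOne H u v a).Adj (Sum.inr 2) x ↔
      x = Sum.inl a ∨ x = Sum.inr 0 ∨ x = Sum.inr 1 := by
  rcases x with x | x
  · simp [circOpOne, fromRel_adj]
  · fin_cases x <;> simp [circOpOne, fromRel_adj]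

lemma fin3_cases (m : Fin 3) (hm : m ≠ 2) : m = 0 ∨ m = 1 := by
  revert m; decide

/-- A vertex of a core set has two given neighbours if those are its only possible ones. -/
lemma core_two {W : Type} {r : W → W → Prop} {T : Set W} (hT : IsCoreSet r T) {t b c d : W}
    (ht : t ∈ T) (hd : d ∉ T) (hr : ∀ x, r t x → x = b ∨ x = c ∨ x = d) :
    b ∈ T ∧ c ∈ T ∧ r t b ∧ r t c := by
  obtain ⟨x, hx, y, hy, hxy, ha, hb⟩ := hT t ht
  have := hr x ha
  have := hr y hb
  grind

lemma circTwo_abs {V : Type} (H : SimpleGraph V) (u₁ v₁ u₂ v₂ a : V) (h₁ : H.Adj u₁ v₁)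
    (h₂ : H.Adj u₂ v₂) (hne : s(u₁, v₁) ≠ s(u₂, v₂)) :
    CircAbs H (circOpTwo H u₁ v₁ u₂ v₂ a) ![s(u₁, v₁), s(u₂, v₂), s(u₁, v₁)] a where
  mem m hm := by
    rcases fin3_cases m hm with rfl | rfl
    · exact h₁
    · exact h₂
  inl_inl p q h := by
    rw [circTwo_inl_inl] at h
    refine ⟨h.1, fun m hm => ?_⟩
    rcases fin3_cases m hm with rfl | rfl
    · exact h.2.1
    · exact h.2.2
  two x hx := (circTwo_two ..).1 hx
  deg m hm x hx hx2 r hr hrx T hT h2 hmT := by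
    rcases fin3_cases m hm with rfl | rfl
    · have := core_two hT hmT h2 (fun y hy => (circTwo_zero ..).1 (hr _ _ hy))
      rw [circTwo_zero] at hx
      grind
    · have := core_two hT hmT h2 (fun y hy => (circTwo_one ..).1 (hr _ _ hy))
      rw [circTwo_one] at hx
      grind
  same m m' hm hm' he r hr T hT h2 hmT := by
    rcases fin3_cases m hm with rfl | rfl <;> rcases fin3_cases m' hm' with rfl | rfl
    · exact hmT
    · exact absurd he hne
    · exact absurd he.symm hne
    · exact hmT
  core D S hS r hr T hT h2 hST hD hE := by
    classical
    have n0 : Sum.inr 0 ∈ T → _ := fun h =>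
      core_two hT h h2 (fun y hy => (circTwo_zero ..).1 (hr _ _ hy))
    have n1 : Sum.inr 1 ∈ T → _ := fun h =>
      core_two hT h h2 (fun y hy => (circTwo_one ..).1 (hr _ _ hy))
    have hE0 : s(u₁, v₁) ∈ D → Sum.inr 0 ∉ T := hE 0 (by decide)
    have hE1 : s(u₂, v₂) ∈ D → Sum.inr 1 ∉ T := hE 1 (by decide)
    have key : ∀ p, Sum.inl p ∉ T := by
      refine coreFree_transfer hS T Sum.inl (fun p q => if s(p, q) = s(u₁, v₁) then Sum.inr 0
        else if s(p, q) = s(u₂, v₂) then Sum.inr 1 else Sum.inl q) hT hST ?_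
      intro p x hp hx hpx
      have ha := hr _ _ hpx
      rcases x with x | m
      · rw [circTwo_inl_inl] at ha
        exact ⟨x, hx, ⟨ha.1, fun h => hD _ _ h hpx⟩, by simp only [if_neg ha.2.1, if_neg ha.2.2]⟩
      · have hm : m ≠ 2 := fun h => h2 (h ▸ hx)
        rw [adj_comm] at ha
        rcases fin3_cases m hm with rfl | rfl
        · rw [circTwo_zero] at ha
          rcases ha with ha | ha | ha
          · obtain rfl := Sum.inl_injective ha
            exact ⟨v₁, (n0 hx).2.1, ⟨h₁, fun h => hE0 h hx⟩, by simp only [if_true]⟩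
          · obtain rfl := Sum.inl_injective ha
            refine ⟨u₁, (n0 hx).1, ⟨h₁.symm, fun h => hE0 ?_ hx⟩, ?_⟩
            · rwa [Sym2.eq_swap]
            · rw [if_pos Sym2.eq_swap]
          · cases ha
        · rw [circTwo_one] at ha
          rcases ha with ha | ha | ha
          · obtain rfl := Sum.inl_injective ha
            refine ⟨v₂, (n1 hx).2.1, ⟨h₂, fun h => hE1 h hx⟩, ?_⟩
            simp only [if_neg hne.symm, if_true]
          · obtain rfl := Sum.inl_injective ha
            refine ⟨u₂, (n1 hx).1, ⟨h₂.symm, fun h => hE1 ?_ hx⟩, ?_⟩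
            · rwa [Sym2.eq_swap]
            · rw [Sym2.eq_swap, if_neg hne.symm, if_pos rfl]
          · cases ha
    rintro (p | m) ht
    · exact key p ht
    · have hm : m ≠ 2 := fun h => h2 (h ▸ ht)
      rcases fin3_cases m hm with rfl | rfl
      · exact key _ (n0 ht).1
      · exact key _ (n1 ht).1
  cardE hfin := by
    classical
    have hsub : (Sym2.map Sum.inl '' (H.edgeSet \ {s(u₁, v₁), s(u₂, v₂)})) ∪
        {s(Sum.inr 0, Sum.inl u₁), s(Sum.inr 0, Sum.inl v₁), s(Sum.inr 1, Sum.inl u₂),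
          s(Sum.inr 1, Sum.inl v₂), s(Sum.inr 2, Sum.inl a), s(Sum.inr 2, Sum.inr 0),
          s(Sum.inr 2, Sum.inr 1)} ⊆ (circOpTwo H u₁ v₁ u₂ v₂ a).edgeSet := by
      rintro e (⟨e, he, rfl⟩ | he)
      · induction e with | _ p q
        rw [Sym2.map_mk, mem_edgeSet, circTwo_inl_inl]
        simpa only [Set.mem_sdiff, mem_edgeSet, Set.mem_insert_iff, Set.mem_singleton_iff,
          not_or] using he
      · rcases he with rfl | rfl | rfl | rfl | rfl | rfl | rfl <;>
          simp [circTwo_zero, circTwo_one, circTwo_two]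
    have h3 := Set.ncard_le_ncard hsub (Set.toFinite _)
    rw [Set.ncard_union_eq, Set.ncard_image_of_injective _ (Sym2.map.injective Sum.inl_injective)]
      at h3
    · have := ncard_diff_ge H.edgeSet {s(u₁, v₁), s(u₂, v₂)} 2 (by rw [Set.ncard_pair hne])
      have h7 : ({s(Sum.inr 0, Sum.inl u₁), s(Sum.inr 0, Sum.inl v₁), s(Sum.inr 1, Sum.inl u₂),
          s(Sum.inr 1, Sum.inl v₂), s(Sum.inr 2, Sum.inl a), s(Sum.inr 2, Sum.inr 0),
          s(Sum.inr 2, Sum.inr 1)} : Set (Sym2 (V ⊕ Fin 3))).ncard = 7 := by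
        repeat rw [Set.ncard_insert_of_notMem]
        · simp
        all_goals simp [h₁.ne, h₂.ne]
      omega
    · rw [Set.disjoint_left]
      rintro _ ⟨e, he, rfl⟩ h2
      induction e with | _ p q
      simp at h2

lemma circOne_abs {V : Type} (H : SimpleGraph V) (u v a : V) (h₁ : H.Adj u v) :
    CircAbs H (circOpOne H u v a) (fun _ => s(u, v)) a where
  mem m hm := h₁
  inl_inl p q h := by
    rw [circOne_inl_inl] at h
    exact ⟨h.1, fun m hm => h.2⟩
  two x hx := (circOne_two ..).1 hx
  deg m hm x hx hx2 r hr hrx T hT h2 hmT := by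
    rcases fin3_cases m hm with rfl | rfl
    · have := core_two hT hmT h2 (fun y hy => (circOne_zero ..).1 (hr _ _ hy))
      rw [circOne_zero] at hx
      grind
    · have := core_two hT hmT h2 (fun y hy => (circOne_one ..).1 (hr _ _ hy))
      rw [circOne_one] at hx
      grind
  same m m' hm hm' he r hr T hT h2 hmT := by
    have n0 : Sum.inr 0 ∈ T → _ := fun h =>
      core_two hT h h2 (fun y hy => (circOne_zero ..).1 (hr _ _ hy))
    have n1 : Sum.inr 1 ∈ T → _ := fun h =>
      core_two hT h h2 (fun y hy => (circOne_one ..).1 (hr _ _ hy))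
    rcases fin3_cases m hm with rfl | rfl <;> rcases fin3_cases m' hm' with rfl | rfl
    · exact hmT
    · exact fun h => hmT (n1 h).2.1
    · exact fun h => hmT (n0 h).2.1
    · exact hmT
  core D S hS r hr T hT h2 hST hD hE := by
    classical
    have n0 : Sum.inr 0 ∈ T → _ := fun h =>
      core_two hT h h2 (fun y hy => (circOne_zero ..).1 (hr _ _ hy))
    have n1 : Sum.inr 1 ∈ T → _ := fun h =>
      core_two hT h h2 (fun y hy => (circOne_one ..).1 (hr _ _ hy))
    have key : ∀ p, Sum.inl p ∉ T := by
      refine coreFree_transfer hS T Sum.inl (fun p q => if s(p, q) = s(u, v) then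
        (if p = u then Sum.inr 0 else Sum.inr 1) else Sum.inl q) hT hST ?_
      intro p x hp hx hpx
      have ha := hr _ _ hpx
      rcases x with x | m
      · rw [circOne_inl_inl] at ha
        exact ⟨x, hx, ⟨ha.1, fun h => hD _ _ h hpx⟩, by simp only [if_neg ha.2]⟩
      · have hm : m ≠ 2 := fun h => h2 (h ▸ hx)
        rw [adj_comm] at ha
        rcases fin3_cases m hm with rfl | rfl
        · rw [circOne_zero] at ha
          rcases ha with ha | ha | ha
          · obtain rfl := Sum.inl_injective ha
            exact ⟨v, (n1 (n0 hx).2.1).1, ⟨h₁, fun h => hE 0 hm h hx⟩, by simp only [if_true]⟩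
          · cases ha
          · cases ha
        · rw [circOne_one] at ha
          rcases ha with ha | ha | ha
          · obtain rfl := Sum.inl_injective ha
            refine ⟨u, (n0 (n1 hx).2.1).1, ⟨h₁.symm, fun h => hE 1 hm ?_ hx⟩, ?_⟩
            · rwa [Sym2.eq_swap]
            · rw [if_pos Sym2.eq_swap, if_neg h₁.ne']
          · cases ha
          · cases ha
    rintro (p | m) ht
    · exact key p ht
    · have hm : m ≠ 2 := fun h => h2 (h ▸ ht)
      rcases fin3_cases m hm with rfl | rfl
      · exact key _ (n0 ht).1
      · exact key _ (n1 ht).1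
  cardE hfin := by
    classical
    have hsub : (Sym2.map Sum.inl '' (H.edgeSet \ {s(u, v)})) ∪
        {s(Sum.inr 0, Sum.inl u), s(Sum.inr 0, Sum.inr 1), s(Sum.inr 1, Sum.inl v),
          s(Sum.inr 2, Sum.inl a), s(Sum.inr 2, Sum.inr 0),
          s(Sum.inr 2, Sum.inr 1)} ⊆ (circOpOne H u v a).edgeSet := by
      rintro e (⟨e, he, rfl⟩ | he)
      · induction e with | _ p q
        rw [Sym2.map_mk, mem_edgeSet, circOne_inl_inl]
        exact he
      · rcases he with rfl | rfl | rfl | rfl | rfl | rfl <;>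
          simp [circOne_zero, circOne_one, circOne_two]
    have h3 := Set.ncard_le_ncard hsub (Set.toFinite _)
    rw [Set.ncard_union_eq, Set.ncard_image_of_injective _ (Sym2.map.injective Sum.inl_injective)]
      at h3
    · have := ncard_diff_ge H.edgeSet {s(u, v)} 1 (by simp)
      have h7 : ({s(Sum.inr 0, Sum.inl u), s(Sum.inr 0, Sum.inr 1), s(Sum.inr 1, Sum.inl v),
          s(Sum.inr 2, Sum.inl a), s(Sum.inr 2, Sum.inr 0),
          s(Sum.inr 2, Sum.inr 1)} : Set (Sym2 (V ⊕ Fin 3))).ncard = 6 := by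
        repeat rw [Set.ncard_insert_of_notMem]
        · simp
        all_goals simp
      omega
    · rw [Set.disjoint_left]
      rintro _ ⟨e, he, rfl⟩ h2
      induction e with | _ p q
      simp at h2

lemma inv_of_isInF {i j : ℕ} {V : Type} {G : SimpleGraph V} (h : IsInF i j G) : FInv i j G := by
  induction h with
  | cycle i hi => exact inv_cycle i hi
  | k4 => exact inv_k4
  | subdiv huv _ ih => exact inv_subdiv huv ih
  | op ha hG _ ih =>
    rcases hG with ⟨u₁, v₁, u₂, v₂, h₁, h₂, hne, rfl⟩ | ⟨u, v, h₁, rfl⟩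
    · exact inv_circAbs (circTwo_abs _ _ _ _ _ _ h₁ h₂ hne) ih
    · exact inv_circAbs (circOne_abs _ _ _ _ h₁) ih
  | iso e _ ih => exact inv_iso e.some ih

lemma phi_induce_le {V : Type} (G : SimpleGraph V) (v : V) (S : Finset V) (hv : v ∈ S)
    (hS : CoreFree G.Adj S) : phi (G.induce {u : V | u ≠ v}) + 1 ≤ S.card := by
  classical
  have h1 : phi (G.induce {u : V | u ≠ v}) ≤ (S.subtype (· ∈ {u : V | u ≠ v})).card := by
    apply Nat.sInf_le
    refine ⟨_, rfl, coreFree_acyclic _ _ ?_⟩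
    intro T hT h2 t ht
    refine hS (Subtype.val '' T) ?_ ?_ t.1 ⟨t, ht, rfl⟩
    · rintro _ ⟨t, ht, rfl⟩ h
      exact hT t ht (by simpa using h)
    · rintro _ ⟨t, ht, rfl⟩
      obtain ⟨x, hx, y, hy, hxy, ha, hb⟩ := h2 t ht
      exact ⟨x, ⟨x, hx, rfl⟩, y, ⟨y, hy, rfl⟩, fun h => hxy (Subtype.ext h), ha, hb⟩
  have h2 : (S.subtype (· ∈ {u : V | u ≠ v})).card < S.card := by
    rw [Finset.card_subtype]
    apply Finset.card_lt_card
    rw [Finset.filter_ssubset]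
    exact ⟨v, hv, by simp⟩
  omega

/-- Let `i ≥ 1`, `0 ≤ j ≤ i`, `G ∈ F_{i,j}`, and set `ε = (5−i)/7` if `i ≤ 5`
and `ε = 0` if `i ≥ 5`. Then `φ(G − v) ≤ (2|E(G)| − |V(G)| + 2)/7 + ε − 1` for every vertex
`v` of `G`; in particular, for every vertex `v` there is a feedback vertex set `S` of `G`
with `v ∈ S` and `|S| ≤ (2|E(G)| − |V(G)| + 2)/7 + ε`. -/
theorem statement_11 (i j : ℕ) (hi : 1 ≤ i) (hj : j ≤ i) {V : Type} (G : SimpleGraph V)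
    (hG : IsInF i j G) (ε : ℝ)
    (hε₁ : i ≤ 5 → ε = (5 - (i : ℝ)) / 7) (hε₂ : 5 ≤ i → ε = 0) (v : V) :
    (phi (G.induce {u : V | u ≠ v}) : ℝ) ≤
        (2 * (G.edgeSet.ncard : ℝ) - (Nat.card V : ℝ) + 2) / 7 + ε - 1 ∧
      ∃ S : Finset V, v ∈ S ∧ (G.induce ((S : Set V)ᶜ)).IsAcyclic ∧
        (S.card : ℝ) ≤ (2 * (G.edgeSet.ncard : ℝ) - (Nat.card V : ℝ) + 2) / 7 + ε := by
  have h := inv_of_isInF hG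
  obtain ⟨S, hv, hc, hS⟩ := h.vert v
  have key : (j : ℝ) + 1 ≤
      (2 * (G.edgeSet.ncard : ℝ) - (Nat.card V : ℝ) + 2) / 7 + ε := by
    have hE : (i : ℝ) + 5 * j ≤ G.edgeSet.ncard := by exact_mod_cast h.cardE
    have hV : (Nat.card V : ℝ) = i + 3 * j := by exact_mod_cast h.cardV
    rw [hV]
    rcases le_total i 5 with h5 | h5
    · rw [hε₁ h5]; linarith
    · rw [hε₂ h5]
      have : (5 : ℝ) ≤ i := by exact_mod_cast h5
      linarith
  have hc' : (S.card : ℝ) ≤ j + 1 := by exact_mod_cast hc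
  refine ⟨?_, S, hv, coreFree_acyclic G S hS, hc'.trans key⟩
  have : (phi (G.induce {u : V | u ≠ v}) : ℝ) + 1 ≤ S.card := by
    exact_mod_cast phi_induce_le G v S hv hS
  linarith
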